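/- arXiv:math/9903120 — 2 statements merged into one kernel-verified Lean document; each statement's English description precedes it below -/
import Mathlib

section
/- Let K be an algebraically closed field, let α, β, γ ∈ K with β ≠ 0, and let A = A(α,β,γ) be the down-up algebra. Then every unit of A is a nonzero scalar: if a ∈ A is a unit, then a = algebraMap K A (c) for some c ∈ K with c ≠ 0. -/
noncomputable section

/-- The defining relations of the down-up algebra `A(α,β,γ)`:
generator `0` is `d`, generator `1` is `u`. -/
inductive DownUpRel (K : Type) [Field K] (α β γ : K) :
    FreeAlgebra K (Fin 2) → FreeAlgebra K (Fin 2) → Prop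
  | rel1 : DownUpRel K α β γ
      (FreeAlgebra.ι K 0 * FreeAlgebra.ι K 0 * FreeAlgebra.ι K 1)
      (α • (FreeAlgebra.ι K 0 * FreeAlgebra.ι K 1 * FreeAlgebra.ι K 0) +
        β • (FreeAlgebra.ι K 1 * FreeAlgebra.ι K 0 * FreeAlgebra.ι K 0) +
        γ • FreeAlgebra.ι K 0)
  | rel2 : DownUpRel K α β γ
      (FreeAlgebra.ι K 0 * FreeAlgebra.ι K 1 * FreeAlgebra.ι K 1)
      (α • (FreeAlgebra.ι K 1 * FreeAlgebra.ι K 0 * FreeAlgebra.ι K 1) +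
        β • (FreeAlgebra.ι K 1 * FreeAlgebra.ι K 1 * FreeAlgebra.ι K 0) +
        γ • FreeAlgebra.ι K 1)

/-- The down-up algebra `A(α,β,γ)`. -/
abbrev DownUp (K : Type) [Field K] (α β γ : K) := RingQuot (DownUpRel K α β γ)

/-- The generator `d` of the down-up algebra. -/
def DownUp.d (K : Type) [Field K] (α β γ : K) : DownUp K α β γ :=
  RingQuot.mkAlgHom K (DownUpRel K α β γ) (FreeAlgebra.ι K 0)

/-- The generator `u` of the down-up algebra. -/
def DownUp.u (K : Type) [Field K] (α β γ : K) : DownUp K α β γ :=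
  RingQuot.mkAlgHom K (DownUpRel K α β γ) (FreeAlgebra.ι K 1)

namespace SkewMonoidAlgebra

/-- In a skew group algebra, the coefficient of a product at a uniquely attained
product of degrees is a product of coefficients. -/
theorem coeff_mul_of_uniqueMul {k G : Type*} [Ring k] [Group G] [MulSemiringAction G k]
    (f g : SkewMonoidAlgebra k G) {x y : G} (hx : x ∈ f.support) (hy : y ∈ g.support)
    (h : UniqueMul f.support g.support x y) :
    (f * g).coeff (x * y) = f.coeff x * x • g.coeff y := by
  classical
  rw [coeff_mul, sum_def', Finset.sum_eq_single x, sum_def', Finset.sum_eq_single y]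
  · simp
  · intro b hb hne
    rw [if_neg]
    intro he
    exact hne (mul_left_cancel he)
  · intro hn
    exact absurd hy hn
  · intro a ha hne
    rw [sum_def']
    refine Finset.sum_eq_zero fun b hb => ?_
    rw [if_neg]
    intro he
    exact hne (h ha hb he).1
  · intro hn
    exact absurd hx hn

/-- The factors of a product equal to one in a skew group algebra over a domain are homogeneous when
the group has the two unique products property. -/
theorem exists_single_of_mul_eq_one {k G : Type*} [Ring k] [IsDomain k] [Group G]
    [TwoUniqueProds G] [MulSemiringAction G k] {f g : SkewMonoidAlgebra k G} (h : f * g = 1) :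
    ∃ x y r s, f = single x r ∧ g = single y s ∧ x * y = 1 ∧ r * x • s = 1 := by
  classical
  have key : ∀ x ∈ f.support, ∀ y ∈ g.support, UniqueMul f.support g.support x y →
      x * y = 1 := by
    intro x hx y hy hu
    have h1 := coeff_mul_of_uniqueMul f g hx hy hu
    rw [mem_support_iff] at hx hy
    by_contra hne
    rw [h, coeff_one, Finsupp.single_eq_of_ne hne] at h1
    exact mul_ne_zero hx ((smul_ne_zero_iff_ne x).2 hy) h1.symm
  have hf : f ≠ 0 := by
    rintro rfl
    simp at h
  have hg : g ≠ 0 := by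
    rintro rfl
    simp at h
  have hf' : f.support.Nonempty := by
    rw [Finset.nonempty_iff_ne_empty]
    exact fun h0 => hf (support_eq_empty.1 h0)
  have hg' : g.support.Nonempty := by
    rw [Finset.nonempty_iff_ne_empty]
    exact fun h0 => hg (support_eq_empty.1 h0)
  have hcard : f.support.card * g.support.card ≤ 1 := by
    by_contra! hlt
    obtain ⟨p, hp, q, hq, hne, hup, huq⟩ := TwoUniqueProds.uniqueMul_of_one_lt_card hlt
    rw [Finset.mem_product] at hp hq
    have h1 := key _ hp.1 _ hp.2 hup
    have h2 := key _ hq.1 _ hq.2 huq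
    have := hup hq.1 hq.2 (h2.trans h1.symm)
    exact hne (Prod.ext this.1.symm this.2.symm)
  have hfc := hf'.card_pos
  have hgc := hg'.card_pos
  have hf1 : f.support.card = 1 := by nlinarith
  have hg1 : g.support.card = 1 := by nlinarith
  have hom : ∀ e : SkewMonoidAlgebra k G, e.support.card = 1 → ∃ x r, e = single x r := by
    intro e he
    obtain ⟨x, r, -, hr⟩ := Finsupp.card_support_eq_one'.1 he
    exact ⟨x, r, coeff_injective hr⟩
  obtain ⟨x, r, rfl⟩ := hom f hf1
  obtain ⟨y, s, rfl⟩ := hom g hg1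
  rw [single_mul_single, one_def] at h
  have hxy : x * y = 1 := by
    by_contra hne
    have := congrArg (fun e => coeff e 1) h
    simp [coeff_single, Finsupp.single_eq_of_ne (Ne.symm hne)] at this
  refine ⟨x, y, r, s, rfl, rfl, hxy, ?_⟩
  rw [hxy] at h
  exact single_injective _ h

end SkewMonoidAlgebra

/-- The infinite cyclic group, acting on an algebra through a given automorphism. -/
def CyclicAct {K R : Type*} [CommSemiring K] [Semiring R] [Algebra K R] (_σ : R ≃ₐ[K] R) :=
  Multiplicative ℤ

namespace CyclicAct

variable {K R : Type*} [CommSemiring K] [Semiring R] [Algebra K R] (σ : R ≃ₐ[K] R)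

instance : CommGroup (CyclicAct σ) := inferInstanceAs (CommGroup (Multiplicative ℤ))

instance : TwoUniqueProds (CyclicAct σ) := inferInstanceAs (TwoUniqueProds (Multiplicative ℤ))

instance : MulSemiringAction (CyclicAct σ) R :=
  MulSemiringAction.compHom R (zpowersHom (R ≃ₐ[K] R) σ)

/-- The element of the cyclic group acting as the `n`-th power of the automorphism. -/
def pow (n : ℤ) : CyclicAct σ := Multiplicative.ofAdd n

theorem pow_smul (n : ℤ) (p : R) : pow σ n • p = (σ ^ n) p := rfl

theorem pow_mul (m n : ℤ) : pow σ m * pow σ n = pow σ (m + n) := rfl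

theorem pow_zero : pow σ 0 = 1 := rfl

theorem pow_injective : Function.Injective (pow σ) := Multiplicative.ofAdd.injective

theorem pow_surjective : Function.Surjective (pow σ) := Multiplicative.ofAdd.surjective

instance : SMulCommClass (CyclicAct σ) K R where
  smul_comm g c p := by
    obtain ⟨n, rfl⟩ := pow_surjective σ g
    simp only [pow_smul, map_smul]

end CyclicAct

namespace DownUp

open MvPolynomial SkewMonoidAlgebra

variable {K : Type} [Field K] {α β γ : K}

theorem d_mul_d_mul_u : d K α β γ * d K α β γ * u K α β γ =
    α • (d K α β γ * u K α β γ * d K α β γ) + β • (u K α β γ * d K α β γ * d K α β γ) +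
      γ • d K α β γ := by
  have h := RingQuot.mkAlgHom_rel K (DownUpRel.rel1 (K := K) (α := α) (β := β) (γ := γ))
  simp only [map_mul, map_add, map_smul] at h
  exact h

theorem d_mul_u_mul_u : d K α β γ * u K α β γ * u K α β γ =
    α • (u K α β γ * d K α β γ * u K α β γ) + β • (u K α β γ * u K α β γ * d K α β γ) +
      γ • u K α β γ := by
  have h := RingQuot.mkAlgHom_rel K (DownUpRel.rel2 (K := K) (α := α) (β := β) (γ := γ))
  simp only [map_mul, map_add, map_smul] at h
  exact h

theorem commute_ud_du :
    Commute (u K α β γ * d K α β γ) (d K α β γ * u K α β γ) := by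
  have h1 : u K α β γ * d K α β γ * (d K α β γ * u K α β γ) =
      u K α β γ * (d K α β γ * d K α β γ * u K α β γ) := by simp only [mul_assoc]
  have h2 : d K α β γ * u K α β γ * (u K α β γ * d K α β γ) =
      (d K α β γ * u K α β γ * u K α β γ) * d K α β γ := by simp only [mul_assoc]
  rw [Commute, SemiconjBy, h1, h2, d_mul_d_mul_u, d_mul_u_mul_u]
  simp only [mul_add, add_mul, mul_smul_comm, smul_mul_assoc, mul_assoc]

open scoped IsMulCommutative in
variable (α β γ) in
theorem exists_eval : ∃ e : MvPolynomial (Fin 2) K →ₐ[K] DownUp K α β γ,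
    e (X 0) = u K α β γ * d K α β γ ∧ e (X 1) = d K α β γ * u K α β γ := by
  let s : Set (DownUp K α β γ) := {u K α β γ * d K α β γ, d K α β γ * u K α β γ}
  have hs : ∀ a ∈ s, ∀ b ∈ s, a * b = b * a := by
    have h := commute_ud_du (α := α) (β := β) (γ := γ)
    rintro a (rfl | rfl) b (rfl | rfl)
    · rfl
    · exact h
    · exact h.symm
    · rfl
  have := Algebra.isMulCommutative_adjoin K hs
  let x : Algebra.adjoin K s := ⟨_, Algebra.subset_adjoin (Set.mem_insert _ _)⟩
  let y : Algebra.adjoin K s :=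
    ⟨_, Algebra.subset_adjoin (Set.mem_insert_of_mem _ (Set.mem_singleton _))⟩
  refine ⟨(Algebra.adjoin K s).val.comp (aeval ![x, y]), ?_, ?_⟩ <;> simp [x, y]

variable (α β γ) in
/-- The homomorphism from the polynomial ring in two variables to the down-up algebra sending the
variables to `ud` and `du`. -/
def eval : MvPolynomial (Fin 2) K →ₐ[K] DownUp K α β γ := (exists_eval α β γ).choose

@[simp]
theorem eval_X_zero : eval α β γ (X 0) = u K α β γ * d K α β γ :=
  (exists_eval α β γ).choose_spec.1

@[simp]
theorem eval_X_one : eval α β γ (X 1) = d K α β γ * u K α β γ :=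
  (exists_eval α β γ).choose_spec.2

variable (α γ) in
/-- The automorphism of the polynomial ring describing conjugation by `d`. -/
def twist (hβ : β ≠ 0) : MvPolynomial (Fin 2) K ≃ₐ[K] MvPolynomial (Fin 2) K :=
  AlgEquiv.ofAlgHom (aeval ![X 1, C α * X 1 + C β * X 0 + C γ])
    (aeval ![C β⁻¹ * (X 1 - C α * X 0 - C γ), X 0])
    (by
      have h : C (σ := Fin 2) β⁻¹ * C β = 1 := by rw [← C_mul, inv_mul_cancel₀ hβ, C_1]
      refine algHom_ext fun i => ?_
      fin_cases i
      · simp [algebraMap_eq]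
        linear_combination (X 0 : MvPolynomial (Fin 2) K) * h
      · simp)
    (by
      have h : C (σ := Fin 2) β⁻¹ * C β = 1 := by rw [← C_mul, inv_mul_cancel₀ hβ, C_1]
      refine algHom_ext fun i => ?_
      fin_cases i
      · simp
      · simp [algebraMap_eq]
        linear_combination (X 1 - C α * X 0 - C γ : MvPolynomial (Fin 2) K) * h)

section

variable (hβ : β ≠ 0)

theorem twist_X_zero : twist α γ hβ (X 0) = X 1 := by
  simp [twist]

theorem twist_X_one : twist α γ hβ (X 1) = C α * X 1 + C β * X 0 + C γ := by
  simp [twist]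

theorem eval_C (c : K) : eval α β γ (C c) = algebraMap K _ c := by
  rw [← algebraMap_eq, AlgHom.commutes]

theorem d_mul_eval (p : MvPolynomial (Fin 2) K) :
    d K α β γ * eval α β γ p = eval α β γ (twist α γ hβ p) * d K α β γ := by
  induction p using MvPolynomial.induction_on with
  | C c =>
    rw [← algebraMap_eq, AlgEquiv.commutes, AlgHom.commutes]
    exact (Algebra.commutes _ _).symm
  | add p q hp hq => simp only [map_add, mul_add, add_mul, hp, hq]
  | mul_X p i hp =>
    rw [map_mul, map_mul, map_mul, ← mul_assoc, hp, mul_assoc, mul_assoc]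
    congr 1
    fin_cases i
    · simp [twist_X_zero, mul_assoc]
    · have h := d_mul_d_mul_u (K := K) (α := α) (β := β) (γ := γ)
      simp only [mul_assoc] at h
      simp [twist_X_one, add_mul, mul_assoc, h, Algebra.smul_def]

theorem u_mul_eval_twist (p : MvPolynomial (Fin 2) K) :
    u K α β γ * eval α β γ (twist α γ hβ p) = eval α β γ p * u K α β γ := by
  induction p using MvPolynomial.induction_on with
  | C c =>
    rw [← algebraMap_eq, AlgEquiv.commutes, AlgHom.commutes]
    exact (Algebra.commutes _ _).symm
  | add p q hp hq => simp only [map_add, mul_add, add_mul, hp, hq]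
  | mul_X p i hp =>
    rw [map_mul, map_mul, map_mul, ← mul_assoc, hp, mul_assoc, mul_assoc]
    congr 1
    fin_cases i
    · simp [twist_X_zero, mul_assoc]
    · have h := d_mul_u_mul_u (K := K) (α := α) (β := β) (γ := γ)
      simp [twist_X_one, mul_add, h, Algebra.algebraMap_eq_smul_one,
        mul_assoc]

theorem u_mul_eval (p : MvPolynomial (Fin 2) K) :
    u K α β γ * eval α β γ p = eval α β γ ((twist α γ hβ).symm p) * u K α β γ := by
  rw [← u_mul_eval_twist hβ, AlgEquiv.apply_symm_apply]

variable (K α β γ) in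
/-- The homogeneous element `d ^ n` for `n ≥ 0` and `u ^ (-n)` for `n < 0`. -/
def homog : ℤ → DownUp K α β γ
  | .ofNat n => d K α β γ ^ n
  | .negSucc n => u K α β γ ^ (n + 1)

variable (K α β γ) in
/-- The normal form map, sending a family of polynomials to the corresponding combination of
the homogeneous elements. -/
def normalForm : (ℤ →₀ MvPolynomial (Fin 2) K) →ₗ[K] DownUp K α β γ :=
  Finsupp.lsum K fun n => (LinearMap.mulRight K (homog K α β γ n)).comp (eval α β γ).toLinearMap

theorem normalForm_single (n : ℤ) (p : MvPolynomial (Fin 2) K) :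
    normalForm K α β γ (Finsupp.single n p) = eval α β γ p * homog K α β γ n := by
  simp [normalForm]

theorem d_mul_homog (n : ℤ) :
    ∃ q, d K α β γ * homog K α β γ n = eval α β γ q * homog K α β γ (n + 1) := by
  rcases n with n | n
  · exact ⟨1, by rw [map_one, one_mul]; exact (pow_succ' _ n).symm⟩
  · refine ⟨X 1, ?_⟩
    rw [eval_X_one]
    cases n with
    | zero => simp [homog]
    | succ n =>
      rw [show (Int.negSucc (n + 1) + 1 : ℤ) = Int.negSucc n by omega]
      simp only [homog, pow_succ' _ (n + 1), mul_assoc]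

theorem u_mul_homog (n : ℤ) :
    ∃ q, u K α β γ * homog K α β γ n = eval α β γ q * homog K α β γ (n - 1) := by
  rcases n with (_ | n) | n
  · exact ⟨1, by
      rw [show (Int.ofNat 0 - 1 : ℤ) = Int.negSucc 0 from rfl]
      simp [homog]⟩
  · refine ⟨X 0, ?_⟩
    rw [eval_X_zero, show (Int.ofNat (n + 1) - 1 : ℤ) = Int.ofNat n by simp]
    simp only [homog, pow_succ', mul_assoc]
  · refine ⟨1, ?_⟩
    rw [show (Int.negSucc n - 1 : ℤ) = Int.negSucc (n + 1) by omega]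
    simp only [homog, pow_succ' _ (n + 1), map_one, one_mul]

theorem d_mul_mem_range (hβ : β ≠ 0) {b : DownUp K α β γ}
    (hb : b ∈ LinearMap.range (normalForm K α β γ)) :
    d K α β γ * b ∈ LinearMap.range (normalForm K α β γ) := by
  obtain ⟨f, rfl⟩ := hb
  induction f using Finsupp.induction_linear with
  | zero => simp
  | add f g hf hg =>
    rw [map_add, mul_add]
    exact add_mem hf hg
  | single n p =>
    obtain ⟨q, hq⟩ := d_mul_homog (K := K) (α := α) (β := β) (γ := γ) n
    refine ⟨Finsupp.single (n + 1) (twist α γ hβ p * q), ?_⟩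
    rw [normalForm_single, normalForm_single, ← mul_assoc, d_mul_eval hβ, mul_assoc, hq, map_mul,
      mul_assoc]

theorem u_mul_mem_range (hβ : β ≠ 0) {b : DownUp K α β γ}
    (hb : b ∈ LinearMap.range (normalForm K α β γ)) :
    u K α β γ * b ∈ LinearMap.range (normalForm K α β γ) := by
  obtain ⟨f, rfl⟩ := hb
  induction f using Finsupp.induction_linear with
  | zero => simp
  | add f g hf hg =>
    rw [map_add, mul_add]
    exact add_mem hf hg
  | single n p =>
    obtain ⟨q, hq⟩ := u_mul_homog (K := K) (α := α) (β := β) (γ := γ) n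
    refine ⟨Finsupp.single (n - 1) ((twist α γ hβ).symm p * q), ?_⟩
    rw [normalForm_single, normalForm_single, ← mul_assoc, u_mul_eval hβ, mul_assoc, hq, map_mul,
      mul_assoc]

theorem normalForm_surjective (hβ : β ≠ 0) : Function.Surjective (normalForm K α β γ) := by
  have key : ∀ a : FreeAlgebra K (Fin 2), ∀ b ∈ LinearMap.range (normalForm K α β γ),
      RingQuot.mkAlgHom K (DownUpRel K α β γ) a * b ∈ LinearMap.range (normalForm K α β γ) := by
    intro a
    induction a using FreeAlgebra.induction with
    | grade0 c =>
      intro b hb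
      rw [AlgHom.commutes, ← Algebra.smul_def]
      exact Submodule.smul_mem _ _ hb
    | grade1 i =>
      intro b hb
      fin_cases i
      · exact d_mul_mem_range hβ hb
      · exact u_mul_mem_range hβ hb
    | mul a a' h h' =>
      intro b hb
      rw [map_mul, mul_assoc]
      exact h _ (h' _ hb)
    | add a a' h h' =>
      intro b hb
      rw [map_add, add_mul]
      exact add_mem (h _ hb) (h' _ hb)
  intro a
  obtain ⟨a, rfl⟩ := RingQuot.mkAlgHom_surjective K (DownUpRel K α β γ) a
  have h1 : (1 : DownUp K α β γ) ∈ LinearMap.range (normalForm K α β γ) :=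
    ⟨Finsupp.single 0 1, by
      rw [normalForm_single, map_one, one_mul]
      exact _root_.pow_zero _⟩
  simpa using key a 1 h1

variable (α γ) in
/-- The ring of skew Laurent polynomials over `K[x, y]` twisted by the automorphism `twist`. -/
abbrev SkewLaurent := SkewMonoidAlgebra (MvPolynomial (Fin 2) K) (CyclicAct (twist α γ hβ))

variable (α γ) in
/-- The homomorphism from the down-up algebra to skew Laurent polynomials with `d ↦ t` and
`u ↦ x t⁻¹`. -/
def toSkewLaurent : DownUp K α β γ →ₐ[K] SkewLaurent α γ hβ :=
  RingQuot.liftAlgHom K ⟨FreeAlgebra.lift K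
    ![single (CyclicAct.pow _ 1) 1, single (CyclicAct.pow _ (-1)) (X 0)], by
    rintro _ _ (_ | _)
    · simp only [map_mul, map_add, map_smul, FreeAlgebra.lift_ι_apply, Matrix.cons_val_zero,
        Matrix.cons_val_one, single_mul_single, CyclicAct.pow_mul, CyclicAct.pow_smul, smul_single]
      simp [← single_add, twist_X_zero, twist_X_one, smul_eq_C_mul]
    · simp only [map_mul, map_add, map_smul, FreeAlgebra.lift_ι_apply, Matrix.cons_val_zero,
        Matrix.cons_val_one, single_mul_single, CyclicAct.pow_mul, CyclicAct.pow_smul, smul_single]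
      simp [← single_add, twist_X_zero, smul_eq_C_mul]
      have h2 : C α * X 0 + C β * (twist α γ hβ).symm (X 0) + C γ = X 1 := by
        have h0 : (twist α γ hβ).symm (X 1) = X 0 := by
          rw [← twist_X_zero hβ (α := α) (γ := γ), AlgEquiv.symm_apply_apply]
        have h1 := (twist α γ hβ).symm_apply_apply (X 1)
        simpa only [twist_X_one, h0, map_add, map_mul, ← algebraMap_eq, AlgEquiv.commutes]
          using h1
      rw [← h2]
      congr 1
      ring⟩

theorem toSkewLaurent_d :
    toSkewLaurent α γ hβ (d K α β γ) = single (CyclicAct.pow _ 1) 1 := by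
  simp [toSkewLaurent, d]

theorem toSkewLaurent_u :
    toSkewLaurent α γ hβ (u K α β γ) = single (CyclicAct.pow _ (-1)) (X 0) := by
  simp [toSkewLaurent, u]

theorem toSkewLaurent_eval (p : MvPolynomial (Fin 2) K) :
    toSkewLaurent α γ hβ (eval α β γ p) = single 1 p := by
  induction p using MvPolynomial.induction_on with
  | C c =>
    rw [eval_C, AlgHom.commutes, coe_algebraMap, Function.comp_apply, algebraMap_eq]
  | add p q hp hq => rw [map_add, map_add, hp, hq, single_add]
  | mul_X p i hp =>
    have hi : toSkewLaurent α γ hβ (eval α β γ (X i)) = single 1 (X i) := by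
      fin_cases i
      · simp [toSkewLaurent_d, toSkewLaurent_u, single_mul_single, CyclicAct.pow_mul,
          CyclicAct.pow_zero]
      · simp [toSkewLaurent_d, toSkewLaurent_u, single_mul_single, CyclicAct.pow_mul,
          CyclicAct.pow_smul, CyclicAct.pow_zero, twist_X_zero]
    rw [map_mul, map_mul, hp, hi, single_mul_single, one_mul, one_smul]

theorem toSkewLaurent_d_pow (n : ℕ) :
    toSkewLaurent α γ hβ (d K α β γ ^ n) = single (CyclicAct.pow _ n) 1 := by
  induction n with
  | zero => simp [CyclicAct.pow_zero]
  | succ n ih =>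
    rw [pow_succ, map_mul, ih, toSkewLaurent_d, single_mul_single, smul_one, mul_one,
      CyclicAct.pow_mul, Nat.cast_succ]

theorem toSkewLaurent_u_pow (n : ℕ) : ∃ c : MvPolynomial (Fin 2) K, c ≠ 0 ∧ X 0 ∣ c ∧
    toSkewLaurent α γ hβ (u K α β γ ^ (n + 1)) =
      single (CyclicAct.pow _ (Int.negSucc n)) c := by
  induction n with
  | zero => exact ⟨X 0, X_ne_zero _, dvd_rfl, by simpa using toSkewLaurent_u hβ⟩
  | succ n ih =>
    obtain ⟨c, hc, -, h⟩ := ih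
    refine ⟨X 0 * (CyclicAct.pow (twist α γ hβ) (-1) • c),
      mul_ne_zero (X_ne_zero _) ((smul_ne_zero_iff_ne _).2 hc), dvd_mul_right _ _, ?_⟩
    rw [pow_succ', map_mul, h, toSkewLaurent_u, single_mul_single, CyclicAct.pow_mul,
      show (-1 + Int.negSucc n : ℤ) = Int.negSucc (n + 1) by omega]

theorem toSkewLaurent_homog (n : ℤ) : ∃ c : MvPolynomial (Fin 2) K, c ≠ 0 ∧
    (n < 0 → X 0 ∣ c) ∧
      toSkewLaurent α γ hβ (homog K α β γ n) = single (CyclicAct.pow _ n) c := by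
  rcases n with n | n
  · exact ⟨1, one_ne_zero, fun h => absurd h (by simp), toSkewLaurent_d_pow hβ n⟩
  · obtain ⟨c, hc, hd, h⟩ := toSkewLaurent_u_pow hβ (α := α) (γ := γ) n
    exact ⟨c, hc, fun _ => hd, h⟩

/-- The coefficients of the skew Laurent polynomial attached to a normal form. -/
theorem exists_coeff_toSkewLaurent_normalForm : ∃ c : ℤ → MvPolynomial (Fin 2) K,
    (∀ n, c n ≠ 0) ∧ (∀ n < 0, X 0 ∣ c n) ∧ ∀ f n,
      (toSkewLaurent α γ hβ (normalForm K α β γ f)).coeff (CyclicAct.pow _ n) = f n * c n := by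
  choose c hc hd h using toSkewLaurent_homog hβ (α := α) (γ := γ)
  refine ⟨c, hc, hd, fun f n => ?_⟩
  induction f using Finsupp.induction_linear with
  | zero => simp
  | add f g hf hg => simp only [map_add, SkewMonoidAlgebra.coeff_add, Finsupp.add_apply, hf, hg, add_mul]
  | single m p =>
    rw [normalForm_single, map_mul, toSkewLaurent_eval, h, single_mul_single, one_mul, one_smul,
      coeff_single]
    by_cases hmn : m = n
    · subst hmn
      simp
    · rw [Finsupp.single_eq_of_ne' hmn,
        Finsupp.single_eq_of_ne' ((CyclicAct.pow_injective _).ne hmn), zero_mul]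

theorem toSkewLaurent_injective : Function.Injective (toSkewLaurent α γ hβ) := by
  obtain ⟨c, hc, -, h⟩ := exists_coeff_toSkewLaurent_normalForm hβ (α := α) (γ := γ)
  rw [injective_iff_map_eq_zero]
  intro a ha
  obtain ⟨f, rfl⟩ := normalForm_surjective hβ a
  have hf : f = 0 := by
    ext1 n
    have hn := h f n
    rw [ha, SkewMonoidAlgebra.coeff_zero, Finsupp.zero_apply] at hn
    exact (mul_eq_zero.1 hn.symm).resolve_right (hc n)
  rw [hf, map_zero]

theorem X_dvd_coeff_toSkewLaurent (a : DownUp K α β γ) {n : ℤ} (hn : n < 0) :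
    X 0 ∣ (toSkewLaurent α γ hβ a).coeff (CyclicAct.pow _ n) := by
  obtain ⟨c, -, hd, h⟩ := exists_coeff_toSkewLaurent_normalForm hβ (α := α) (γ := γ)
  obtain ⟨f, rfl⟩ := normalForm_surjective hβ a
  rw [h]
  exact (hd n hn).mul_left _

theorem nonneg_of_toSkewLaurent_eq_single {a : DownUp K α β γ} {n : ℤ}
    {r : MvPolynomial (Fin 2) K} (hr : IsUnit r)
    (h : toSkewLaurent α γ hβ a = single (CyclicAct.pow _ n) r) : 0 ≤ n := by
  by_contra! hn
  have hd := X_dvd_coeff_toSkewLaurent hβ a hn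
  rw [h, coeff_single, Finsupp.single_eq_same] at hd
  exact (X_prime (R := K) (i := (0 : Fin 2))).not_isUnit (isUnit_of_dvd_unit hd hr)

end

end DownUp

/-- for `β ≠ 0`, every unit of the down-up algebra `A(α,β,γ)`
is a nonzero scalar. -/
theorem downUp_units_are_scalars (K : Type) [Field K] [IsAlgClosed K]
    (α β γ : K) (hβ : β ≠ 0) (a : DownUp K α β γ) (ha : IsUnit a) :
    ∃ c : K, c ≠ 0 ∧ a = algebraMap K (DownUp K α β γ) c := by
  open DownUp SkewMonoidAlgebra in
  obtain ⟨⟨a, b, hab, -⟩, rfl⟩ := ha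
  have h : toSkewLaurent α γ hβ a * toSkewLaurent α γ hβ b = 1 := by
    rw [← map_mul, hab, map_one]
  obtain ⟨x, y, r, s, hx, hy, hxy, hrs⟩ := exists_single_of_mul_eq_one h
  obtain ⟨m, rfl⟩ := CyclicAct.pow_surjective _ x
  obtain ⟨n, rfl⟩ := CyclicAct.pow_surjective _ y
  have hr : IsUnit r := IsUnit.of_mul_eq_one _ hrs
  have hs : IsUnit s := by
    have hs' := IsUnit.of_mul_eq_one _ ((mul_comm _ _).trans hrs)
    exact (MulEquiv.isUnit_map (MulSemiringAction.toRingEquiv _ _ (CyclicAct.pow (twist α γ hβ) m))).1 hs'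
  have hm := nonneg_of_toSkewLaurent_eq_single hβ hr hx
  have hn := nonneg_of_toSkewLaurent_eq_single hβ hs hy
  have hmn : m + n = 0 := CyclicAct.pow_injective _ hxy
  obtain rfl : m = 0 := by omega
  obtain ⟨c, hc, rfl⟩ := MvPolynomial.isUnit_iff_eq_C_of_isReduced.1 hr
  refine ⟨c, hc.ne_zero, toSkewLaurent_injective hβ ?_⟩
  rw [AlgHom.commutes, coe_algebraMap]
  exact hx
end
end

section
/- Let K be an algebraically closed field, let α, β, γ ∈ K (β arbitrary, possibly 0), let A = A(α,β,γ) be the down-up algebra, and let M be a Noetherian left A-module such that every element of M is annihilated by some power of d and by some power of u. Then there exists t ∈ ℕ such that M = M(t), i.e. every element of M is a finite sum of elements m each of which satisfies d^{r+1}·m = 0 and u^{s+1}·m = 0 for some r, s ∈ ℕ with r + s = t. -/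
noncomputable section

section Torsion

variable {K A M : Type*} [Field K] [Ring A] [Algebra K A] [AddCommGroup M] [Module K M]
  [Module A M] [IsScalarTower K A M]

/-- A `K`-subspace stable under generators of `A` contains the `A`-span of each of its subsets. -/
theorem mem_of_mem_span_of_stable {X : Set A} (hX : Algebra.adjoin K X = ⊤)
    (p : Submodule K M) (hp : ∀ x ∈ X, ∀ v ∈ p, x • v ∈ p) {G : Set M} (hG : G ⊆ p)
    {v : M} (hv : v ∈ Submodule.span A G) : v ∈ p := by
  have key : ∀ a ∈ Algebra.adjoin K X, ∀ w ∈ p, a • w ∈ p := by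
    intro a ha
    induction ha using Algebra.adjoin_induction with
    | mem x hx => exact hp x hx
    | algebraMap r => intro w hw; rw [algebraMap_smul]; exact p.smul_mem r hw
    | add x y _ _ hx hy => intro w hw; rw [add_smul]; exact p.add_mem (hx w hw) (hy w hw)
    | mul x y _ _ hx hy => intro w hw; rw [mul_smul]; exact hx _ (hy w hw)
  induction hv using Submodule.span_induction with
  | mem x hx => exact hG hx
  | zero => exact p.zero_mem
  | add x y _ _ hx hy => exact p.add_mem hx hy
  | smul a x _ hx => exact key a (hX ▸ Algebra.mem_top) x hx

theorem pow_smul_eq_zero_of_le {a : A} {v : M} {m n : ℕ} (h : m ≤ n) (hv : a ^ m • v = 0) :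
    a ^ n • v = 0 := by
  rw [← Nat.sub_add_cancel h, pow_add, mul_smul, hv, smul_zero]

theorem Set.Finite.exists_pow_smul_eq_zero {G : Set M} (hG : G.Finite) (a : A)
    (h : ∀ g ∈ G, ∃ n : ℕ, a ^ n • g = 0) : ∃ n : ℕ, ∀ g ∈ G, a ^ n • g = 0 := by
  choose! f hf using h
  obtain ⟨n, hn⟩ := (hG.image f).bddAbove
  exact ⟨n, fun g hg ↦ pow_smul_eq_zero_of_le (hn ⟨g, hg, rfl⟩) (hf g hg)⟩

theorem finite_range_pow_smul {a : A} {v : M} (h : ∃ n : ℕ, a ^ n • v = 0) :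
    (Set.range fun i : ℕ ↦ a ^ i • v).Finite := by
  obtain ⟨n, hn⟩ := h
  refine (((Set.finite_lt_nat n).image fun i ↦ a ^ i • v).union (Set.finite_singleton 0)).subset ?_
  rintro _ ⟨i, rfl⟩
  rcases lt_or_ge i n with hi | hi
  · exact Or.inl ⟨i, hi, rfl⟩
  · exact Or.inr (pow_smul_eq_zero_of_le hi hn)

theorem exists_mul_eq_mul_of_mem_adjoin {X : Set A} {a : A}
    (h : ∀ x ∈ X, ∃ s ∈ Algebra.adjoin K X, a * x = s * a) {x : A}
    (hx : x ∈ Algebra.adjoin K X) : ∃ s ∈ Algebra.adjoin K X, a * x = s * a := by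
  induction hx using Algebra.adjoin_induction with
  | mem x hx => exact h x hx
  | algebraMap r => exact ⟨_, algebraMap_mem _ r, (Algebra.commutes r a).symm⟩
  | add x y _ _ hx hy =>
    obtain ⟨s, hs, hsx⟩ := hx
    obtain ⟨t, ht, hty⟩ := hy
    exact ⟨s + t, add_mem hs ht, by rw [mul_add, add_mul, hsx, hty]⟩
  | mul x y _ _ hx hy =>
    obtain ⟨s, hs, hsx⟩ := hx
    obtain ⟨t, ht, hty⟩ := hy
    exact ⟨s * t, mul_mem hs ht, by rw [← mul_assoc, hsx, mul_assoc, hty, mul_assoc]⟩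

theorem exists_pow_mul_eq_mul_pow {S : Subalgebra K A} {a : A}
    (h : ∀ x ∈ S, ∃ s ∈ S, a * x = s * a) (n : ℕ) {x : A} (hx : x ∈ S) :
    ∃ s ∈ S, a ^ n * x = s * a ^ n := by
  induction n with
  | zero => exact ⟨x, hx, by simp⟩
  | succ n ih =>
    obtain ⟨s, hs, hsx⟩ := ih
    obtain ⟨t, ht, hts⟩ := h s hs
    exact ⟨t, ht, by rw [pow_succ', mul_assoc, hsx, ← mul_assoc, hts, mul_assoc]⟩

theorem pow_smul_eq_zero_of_mem_span_smul {S : Subalgebra K A} {a : A}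
    (h : ∀ x ∈ S, ∃ s ∈ S, a * x = s * a) {n : ℕ} {G : Set M} (hG : ∀ g ∈ G, a ^ n • g = 0)
    {v : M} (hv : v ∈ Submodule.span K {w : M | ∃ s ∈ S, ∃ g ∈ G, w = s • g}) :
    a ^ n • v = 0 := by
  induction hv using Submodule.span_induction with
  | mem x hx =>
    obtain ⟨s, hs, g, hg, rfl⟩ := hx
    obtain ⟨t, -, hts⟩ := exists_pow_mul_eq_mul_pow h n hs
    rw [← mul_smul, hts, mul_smul, hG g hg, smul_zero]
  | zero => exact smul_zero _
  | add x y _ _ hx hy => rw [smul_add, hx, hy, add_zero]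
  | smul c x _ hx => rw [smul_comm, hx, smul_zero]

/-- If `A` is generated by `d` and `u`, and a subalgebra containing `d * u` can be moved to the
left past both generators, then finitely generated modules which are torsion for `d` and `u` have
bounded torsion. -/
theorem exists_pow_smul_eq_zero_of_subalgebra [Module.Finite A M] {d u : A}
    (hA : Algebra.adjoin K {d, u} = ⊤) (S : Subalgebra K A) (hy : d * u ∈ S)
    (hd : ∀ x ∈ S, ∃ s ∈ S, d * x = s * d) (hu : ∀ x ∈ S, ∃ s ∈ S, u * x = s * u)
    (htd : ∀ m : M, ∃ n : ℕ, d ^ n • m = 0) (htu : ∀ m : M, ∃ n : ℕ, u ^ n • m = 0) :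
    ∃ n : ℕ, ∀ m : M, d ^ n • m = 0 ∧ u ^ n • m = 0 := by
  obtain ⟨F, hF⟩ := (Module.Finite.fg_top : (⊤ : Submodule A M).FG)
  set G : Set M := ⋃ m ∈ (F : Set M), ⋃ w ∈ Set.range fun k : ℕ ↦ d ^ k • m,
    Set.range fun i : ℕ ↦ u ^ i • w with hGdef
  have hGfin : G.Finite := F.finite_toSet.biUnion fun m _ ↦
    (finite_range_pow_smul (htd m)).biUnion fun w _ ↦ finite_range_pow_smul (htu w)
  have hG : ∀ g, g ∈ G ↔ ∃ m ∈ F, ∃ k i : ℕ, g = u ^ i • d ^ k • m := by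
    intro g
    simp [hGdef, eq_comm]
  set p := Submodule.span K {w : M | ∃ s ∈ S, ∃ g ∈ G, w = s • g}
  have hstable : ∀ x ∈ ({d, u} : Set A), ∀ v ∈ p, x • v ∈ p := by
    intro x hx v hv
    induction hv using Submodule.span_induction with
    | zero => rw [smul_zero]; exact p.zero_mem
    | add v w _ _ hv hw => rw [smul_add]; exact p.add_mem hv hw
    | smul c v _ hv => rw [smul_comm]; exact p.smul_mem c hv
    | mem v hv =>
      obtain ⟨s, hs, g, hg, rfl⟩ := hv
      obtain ⟨m, hm, k, i, rfl⟩ := (hG g).1 hg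
      rcases hx with rfl | rfl
      · obtain ⟨t, ht, hts⟩ := hd s hs
        rw [← mul_smul, hts, mul_smul]
        rcases i with _ | i
        · refine Submodule.subset_span ⟨t, ht, _, (hG _).2 ⟨m, hm, k + 1, 0, rfl⟩, ?_⟩
          simp only [pow_zero, one_smul, pow_succ', mul_smul]
        · refine Submodule.subset_span
            ⟨t * (x * u), mul_mem ht hy, _, (hG _).2 ⟨m, hm, k, i, rfl⟩, ?_⟩
          simp only [pow_succ', mul_smul]
      · obtain ⟨t, ht, hts⟩ := hu s hs
        rw [← mul_smul, hts, mul_smul]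
        refine Submodule.subset_span ⟨t, ht, _, (hG _).2 ⟨m, hm, k, i + 1, rfl⟩, ?_⟩
        simp only [pow_succ', mul_smul]
  have hp : ∀ v : M, v ∈ p := by
    intro v
    refine mem_of_mem_span_of_stable hA p hstable (G := F) (fun m hm ↦ ?_) (hF ▸ Submodule.mem_top)
    exact Submodule.subset_span ⟨1, one_mem S, m, (hG m).2 ⟨m, hm, 0, 0, by simp⟩, by simp⟩
  obtain ⟨n₁, h₁⟩ := hGfin.exists_pow_smul_eq_zero d fun g _ ↦ htd g
  obtain ⟨n₂, h₂⟩ := hGfin.exists_pow_smul_eq_zero u fun g _ ↦ htu g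
  exact ⟨max n₁ n₂, fun m ↦
    ⟨pow_smul_eq_zero_of_le (le_max_left _ _) (pow_smul_eq_zero_of_mem_span_smul hd h₁ (hp m)),
      pow_smul_eq_zero_of_le (le_max_right _ _) (pow_smul_eq_zero_of_mem_span_smul hu h₂ (hp m))⟩⟩

theorem exists_pow_smul_eq_zero_of_mul_mul_eq_zero [IsNoetherian A M] {d u : A}
    (hA : Algebra.adjoin K {d, u} = ⊤) (h₁ : d * d * u = 0) (h₂ : d * u * u = 0)
    (htd : ∀ m : M, ∃ n : ℕ, d ^ n • m = 0) (htu : ∀ m : M, ∃ n : ℕ, u ^ n • m = 0) :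
    ∃ n : ℕ, ∀ m : M, d ^ n • m = 0 ∧ u ^ n • m = 0 := by
  have h₁' (v : M) : d • d • u • v = 0 := by simp only [← mul_smul, ← mul_assoc, h₁, zero_smul]
  have h₂' (v : M) : d • u • u • v = 0 := by simp only [← mul_smul, ← mul_assoc, h₂, zero_smul]
  obtain ⟨F, hF⟩ := (IsNoetherian.noetherian (⊤ : Submodule A M))
  obtain ⟨n, hn⟩ := F.finite_toSet.exists_pow_smul_eq_zero d fun g _ ↦ htd g
  have hdM (v : M) : d ^ (n + 2) • v = 0 := by
    refine mem_of_mem_span_of_stable hA (LinearMap.ker (Module.toModuleEnd K M (d ^ (n + 2)) :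
      M →ₗ[K] M)) ?_ (G := F) ?_ (hF ▸ Submodule.mem_top)
    · rintro x (rfl | rfl) v hv
      · change x ^ (n + 2) • x • v = 0
        rw [← mul_smul, ← pow_succ, pow_succ', mul_smul]
        exact (congrArg (x • ·) hv).trans (smul_zero x)
      · change d ^ (n + 2) • x • v = 0
        rw [pow_add, pow_two, mul_smul, mul_smul, h₁', smul_zero]
    · intro g hg
      exact pow_smul_eq_zero_of_le (Nat.le_add_right n 2) (hn g hg)
  set Q : Submodule A M := Submodule.span A (Set.range fun m : M ↦ u • u • m)
  obtain ⟨F', hF'⟩ := IsNoetherian.noetherian Q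
  obtain ⟨k, hk⟩ := F'.finite_toSet.exists_pow_smul_eq_zero u fun g _ ↦ htu g
  have hQ₀ (v : M) (hv : v ∈ Q) : d • v = 0 ∧ (d * u) • v = 0 := by
    refine Submodule.mem_inf.1 (mem_of_mem_span_of_stable hA
      (LinearMap.ker (Module.toModuleEnd K M d : M →ₗ[K] M) ⊓
        LinearMap.ker (Module.toModuleEnd K M (d * u) : M →ₗ[K] M)) ?_ ?_ hv)
    · rintro x hx v ⟨hv₁ : d • v = 0, hv₂ : (d * u) • v = 0⟩
      rcases hx with rfl | rfl
      · rw [hv₁]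
        exact Submodule.zero_mem _
      · exact ⟨by rwa [mul_smul] at hv₂, (mul_smul d x _).trans (h₂' v)⟩
    · rintro _ ⟨m, rfl⟩
      exact ⟨h₂' m, (mul_smul d u _).trans (h₂' _)⟩
  have hkQ (v : M) (hv : v ∈ Q) : u ^ k • v = 0 := by
    rw [← hF'] at hv
    refine (Submodule.mem_inf.1 (mem_of_mem_span_of_stable hA (Q.restrictScalars K ⊓
      LinearMap.ker (Module.toModuleEnd K M (u ^ k) : M →ₗ[K] M)) ?_ ?_ hv)).2
    · rintro x hx v ⟨hv₁ : v ∈ Q, hv₂ : u ^ k • v = 0⟩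
      rcases hx with rfl | rfl
      · rw [(hQ₀ v hv₁).1]
        exact Submodule.zero_mem _
      · refine ⟨Q.smul_mem x hv₁, ?_⟩
        change x ^ k • x • v = 0
        rw [← mul_smul, ← pow_succ, pow_succ', mul_smul, hv₂, smul_zero]
    · exact fun g hg ↦ ⟨hF' ▸ Submodule.subset_span hg, hk g hg⟩
  refine ⟨n + 2 + (k + 2), fun m ↦ ⟨pow_smul_eq_zero_of_le (by lia) (hdM m),
    pow_smul_eq_zero_of_le (m := k + 2) (by lia) ?_⟩⟩
  rw [pow_add, pow_two, mul_smul, mul_smul]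
  exact hkQ _ (Submodule.subset_span ⟨m, rfl⟩)

theorem smul_eq_zero_of_mul_mul_eq_smul {d u : A} {γ : K} (hγ : γ ≠ 0)
    (h₁ : d * d * u = γ • d) (h₂ : d * u * u = γ • u)
    (htu : ∀ m : M, ∃ n : ℕ, u ^ n • m = 0) (m : M) : d • m = 0 ∧ u • m = 0 := by
  have hu (v : M) : u • v = 0 := by
    obtain ⟨n, hn⟩ := htu v
    have hn' : u ^ (n + 1) • v = 0 := pow_smul_eq_zero_of_le (Nat.le_succ n) hn
    clear hn
    induction n with
    | zero => simpa using hn'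
    | succ n ih =>
      refine ih ((smul_eq_zero.1 ?_).resolve_left hγ)
      rw [← smul_assoc, pow_succ', ← smul_mul_assoc, ← h₂, mul_assoc, mul_assoc, ← pow_succ',
        ← pow_succ', mul_smul, hn', smul_zero]
  refine ⟨(smul_eq_zero.1 ?_).resolve_left hγ, hu m⟩
  rw [← smul_assoc, ← h₁, mul_smul, hu, smul_zero]

theorem exists_pow_smul_eq_zero_of_downUp_relations [IsNoetherian A M] {d u : A} {α β γ : K}
    (hA : Algebra.adjoin K {d, u} = ⊤)
    (h₁ : d * d * u = α • (d * u * d) + β • (u * d * d) + γ • d)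
    (h₂ : d * u * u = α • (u * d * u) + β • (u * u * d) + γ • u)
    (htd : ∀ m : M, ∃ n : ℕ, d ^ n • m = 0) (htu : ∀ m : M, ∃ n : ℕ, u ^ n • m = 0) :
    ∃ n : ℕ, ∀ m : M, d ^ n • m = 0 ∧ u ^ n • m = 0 := by
  by_cases hβ : β = 0
  · subst hβ
    simp only [zero_smul, add_zero] at h₁ h₂
    by_cases hα : α = 0
    · subst hα
      simp only [zero_smul, zero_add] at h₁ h₂
      by_cases hγ : γ = 0
      · subst hγ
        rw [zero_smul] at h₁ h₂
        exact exists_pow_smul_eq_zero_of_mul_mul_eq_zero hA h₁ h₂ htd htu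
      · exact ⟨1, by simpa using smul_eq_zero_of_mul_mul_eq_smul hγ h₁ h₂ htu⟩
    · have hy : d * u ∈ Algebra.adjoin K {d * u} := Algebra.subset_adjoin rfl
      refine exists_pow_smul_eq_zero_of_subalgebra hA (Algebra.adjoin K {d * u}) hy
        (fun x hx ↦ exists_mul_eq_mul_of_mem_adjoin ?_ hx)
        (fun x hx ↦ exists_mul_eq_mul_of_mem_adjoin ?_ hx) htd htu
      · rintro _ rfl
        refine ⟨α • (d * u) + algebraMap K A γ,
          add_mem (Subalgebra.smul_mem _ hy _) (algebraMap_mem _ _), ?_⟩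
        rw [← mul_assoc, h₁, add_mul, smul_mul_assoc, Algebra.smul_def γ]
      · rintro _ rfl
        refine ⟨α⁻¹ • (d * u - algebraMap K A γ),
          Subalgebra.smul_mem _ (sub_mem hy (algebraMap_mem _ _)) _, ?_⟩
        rw [smul_mul_assoc, sub_mul, h₂, ← Algebra.smul_def, add_sub_cancel_right,
          inv_smul_smul₀ hα, mul_assoc]
  · set S := Algebra.adjoin K {d * u, u * d}
    have hy : d * u ∈ S := Algebra.subset_adjoin (Or.inl rfl)
    have hud : u * d ∈ S := Algebra.subset_adjoin (Or.inr rfl)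
    refine exists_pow_smul_eq_zero_of_subalgebra hA S hy
      (fun x hx ↦ exists_mul_eq_mul_of_mem_adjoin ?_ hx)
      (fun x hx ↦ exists_mul_eq_mul_of_mem_adjoin ?_ hx) htd htu
    · rintro _ (rfl | rfl)
      · refine ⟨α • (d * u) + β • (u * d) + algebraMap K A γ, add_mem (add_mem
          (Subalgebra.smul_mem _ hy _) (Subalgebra.smul_mem _ hud _)) (algebraMap_mem _ _), ?_⟩
        rw [← mul_assoc, h₁, add_mul, add_mul, smul_mul_assoc, smul_mul_assoc,
          Algebra.smul_def γ]
      · exact ⟨d * u, hy, (mul_assoc _ _ _).symm⟩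
    · rintro _ (rfl | rfl)
      · exact ⟨u * d, hud, (mul_assoc _ _ _).symm⟩
      · refine ⟨β⁻¹ • (d * u - α • (u * d) - algebraMap K A γ), Subalgebra.smul_mem _
          (sub_mem (sub_mem hy (Subalgebra.smul_mem _ hud _)) (algebraMap_mem _ _)) _, ?_⟩
        rw [smul_mul_assoc, sub_mul, sub_mul, smul_mul_assoc, h₂, ← Algebra.smul_def,
          eq_inv_smul_iff₀ hβ, ← mul_assoc]
        abel

end Torsion

theorem DownUp.adjoin_d_u (K : Type) [Field K] (α β γ : K) :
    Algebra.adjoin K {DownUp.d K α β γ, DownUp.u K α β γ} = ⊤ := by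
  have h := congrArg (Subalgebra.map (RingQuot.mkAlgHom K (DownUpRel K α β γ)))
    (FreeAlgebra.adjoin_range_ι (R := K) (X := Fin 2))
  rw [AlgHom.map_adjoin, Algebra.map_top,
    (AlgHom.range_eq_top _).2 (RingQuot.mkAlgHom_surjective K _)] at h
  rw [← h]
  congr 1
  ext x
  simp [DownUp.d, DownUp.u, eq_comm]

theorem DownUp.d_mul_d_mul_u_s6 (K : Type) [Field K] (α β γ : K) :
    d K α β γ * d K α β γ * u K α β γ = α • (d K α β γ * u K α β γ * d K α β γ) +
      β • (u K α β γ * d K α β γ * d K α β γ) + γ • d K α β γ := by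
  simpa only [d, u, map_add, map_mul, map_smul] using
    RingQuot.mkAlgHom_rel K (DownUpRel.rel1 (K := K) (α := α) (β := β) (γ := γ))

theorem DownUp.d_mul_u_mul_u_s6 (K : Type) [Field K] (α β γ : K) :
    d K α β γ * u K α β γ * u K α β γ = α • (u K α β γ * d K α β γ * u K α β γ) +
      β • (u K α β γ * u K α β γ * d K α β γ) + γ • u K α β γ := by
  simpa only [d, u, map_add, map_mul, map_smul] using
    RingQuot.mkAlgHom_rel K (DownUpRel.rel2 (K := K) (α := α) (β := β) (γ := γ))

/-- if `M` is a Noetherian left module over a down-up algebra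
(`β` may be zero) in which every element is killed by a power of `d` and by a
power of `u`, then `M = M(t)` for some `t`, where
`M(t) = Σ_{r+s=t} M_r^s` is the (K-linear) span of the elements killed by
`d^{r+1}` and `u^{s+1}` with `r + s = t`. -/
theorem downUp_noetherian_torsion_module_eq_Mt (K : Type) [Field K] [IsAlgClosed K]
    (α β γ : K)
    (M : Type) [AddCommGroup M] [Module K M] [Module (DownUp K α β γ) M]
    [IsScalarTower K (DownUp K α β γ) M]
    [IsNoetherian (DownUp K α β γ) M]
    (htor : ∀ m : M, (∃ r : ℕ, (DownUp.d K α β γ) ^ (r + 1) • m = 0) ∧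
        (∃ s : ℕ, (DownUp.u K α β γ) ^ (s + 1) • m = 0)) :
    ∃ t : ℕ, ∀ m : M,
      m ∈ Submodule.span K {x : M | ∃ r s : ℕ, r + s = t ∧
        (DownUp.d K α β γ) ^ (r + 1) • x = 0 ∧ (DownUp.u K α β γ) ^ (s + 1) • x = 0} := by
  obtain ⟨n, hn⟩ := exists_pow_smul_eq_zero_of_downUp_relations (M := M)
    (DownUp.adjoin_d_u K α β γ) (DownUp.d_mul_d_mul_u_s6 K α β γ) (DownUp.d_mul_u_mul_u_s6 K α β γ)
    (fun m ↦ (htor m).1.imp' (· + 1) fun _ h ↦ h) (fun m ↦ (htor m).2.imp' (· + 1) fun _ h ↦ h)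
  exact ⟨n + n, fun m ↦ Submodule.subset_span ⟨n, n, rfl,
    pow_smul_eq_zero_of_le n.le_succ (hn m).1, pow_smul_eq_zero_of_le n.le_succ (hn m).2⟩⟩
end
end
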